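/- arXiv:q-alg/9710035 — 2 statements merged into one kernel-verified Lean document; each statement's English description precedes it below -/
import Mathlib

section
/- Let 1 ≤ j < l and let m₁ ≥ … ≥ m_j > 0 be integers. Set Ξ^{det}_j := ∏_{p=j+1}^{l} ψ^{+,p}_{−½} ψ^{−,p}_{−½} and v := Ξ^{+,m₁}_1 ⋯ Ξ^{+,m_j}_j Ξ^{det}_j |0⟩ ∈ F. Then: (a) D̂_{ab} v = 0 for all a < b, where D̂_{ab} := Ê_{ab} − Ê_{1−b,1−a}; (b) ê*^{pq} v = 0 for all p < q and ê**^{pq} v = 0 for all p ≠ q; (c) Ê_{kk} v = #{p ≤ j : m_p ≥ k}·v for all k ≥ 2, Ê_{11} v = l·v, Ê_{00} v = (j−l)·v, and Ê_{kk} v = 0 for all k ≤ −1. -/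
/-!
Fermionic Fock space of `l` pairs of fermionic fields indexed by `½ + ℤ`.

The Fock space `FFock l` is the exterior algebra on the vector space `FV l` with basis
`v^{ε,p}_{-r}` for `ε ∈ {+,-}` (encoded as `Bool`, `true = +`), `1 ≤ p ≤ l`
(encoded as `Fin l`) and `r ∈ ½ + ℤ`, `r > 0` (encoded as `n : ℕ` with `r = n + ½`).

For `r > 0`, `ψ^{ε,p}_{-r}` is left exterior multiplication by the basis vector
`v^{ε,p}_{-r}`, and `ψ^{ε,p}_{r}` is the unique odd derivation (i.e. the left
contraction) with `ψ^{ε,p}_{r}(v^{ε',q}_{-r'}) = δ_{ε',-ε} δ_{q,p} δ_{r',r}`.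

A general mode `ψ^{ε,p}_{k - ½}` is encoded by `fermion ε p k` for `k : ℤ`.
-/

noncomputable section

/-- Basis index: `(ε, p, n)` corresponds to `v^{ε,p}_{-(n+½)}`. -/
abbrev FBas (l : ℕ) := Bool × Fin l × ℕ

abbrev FV (l : ℕ) := FBas l →₀ ℂ

/-- The fermionic Fock space: the exterior algebra `Λ(V)`. -/
abbrev FFock (l : ℕ) := ExteriorAlgebra ℂ (FV l)

/-- The vacuum vector `|0⟩ = 1`. -/
def fvac (l : ℕ) : FFock l := 1

/-- Creation operator `ψ^{ε,p}_{-(n+½)}`: left exterior multiplication by `v^{ε,p}_{-(n+½)}`. -/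
def psiCr (l : ℕ) (ε : Bool) (p : Fin l) (n : ℕ) : FFock l → FFock l :=
  fun x => ExteriorAlgebra.ι ℂ (Finsupp.single (ε, p, n) (1 : ℂ)) * x

/-- Annihilation operator `ψ^{ε,p}_{n+½}`: the odd derivation (left contraction) dual to
`v^{-ε,p}_{-(n+½)}`. -/
def psiAn (l : ℕ) (ε : Bool) (p : Fin l) (n : ℕ) : FFock l → FFock l :=
  fun x => CliffordAlgebra.contractLeft (Q := (0 : QuadraticForm ℂ (FV l)))
    (Finsupp.lapply ((!ε, p, n) : FBas l)) x

/-- `fermion ε p k` is the mode `ψ^{ε,p}_{k-½}`, for `k : ℤ`. -/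
def fermion (l : ℕ) (ε : Bool) (p : Fin l) (k : ℤ) : FFock l → FFock l :=
  if k ≤ 0 then psiCr l ε p (-k).toNat else psiAn l ε p (k - 1).toNat

/-- Normal ordered product `:ψ^{ε₁,p₁}_{k₁-½} ψ^{ε₂,p₂}_{k₂-½}:`, which is
`-ψ₂ ψ₁` if `k₁ - ½ > 0 > k₂ - ½` and `ψ₁ ψ₂` otherwise. -/
def nPsi (l : ℕ) (ε₁ : Bool) (p₁ : Fin l) (k₁ : ℤ) (ε₂ : Bool) (p₂ : Fin l) (k₂ : ℤ) :
    FFock l → FFock l :=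
  if 1 ≤ k₁ ∧ k₂ ≤ 0 then fun x => -(fermion l ε₂ p₂ k₂ (fermion l ε₁ p₁ k₁ x))
  else fun x => fermion l ε₁ p₁ k₁ (fermion l ε₂ p₂ k₂ x)

/-- `Ê_{ij} = Σ_{p=1}^{l} :ψ^{+,p}_{½-i} ψ^{-,p}_{j-½}:` (note `½ - i = (1-i) - ½`). -/
def Ehat (l : ℕ) (i j : ℤ) : FFock l → FFock l :=
  fun x => ∑ p : Fin l, nPsi l true p (1 - i) false p j x

/-- `ê*^{pq} = Σ_{r ∈ ½+ℤ} :ψ^{+,p}_{-r} ψ^{-,q}_{r}:`, parametrizing `r = k - ½`, `k : ℤ`;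
only finitely many summands act nonzero on a given vector, so the sum (`∑ᶠ`) is well defined. -/
def estar (l : ℕ) (p q : Fin l) : FFock l → FFock l :=
  fun x => ∑ᶠ k : ℤ, nPsi l true p (1 - k) false q k x

/-- `ê^{pq} = Σ_{r ∈ ½+ℤ} :ψ^{-,p}_{-r} ψ^{-,q}_{r}:`. -/
def ee (l : ℕ) (p q : Fin l) : FFock l → FFock l :=
  fun x => ∑ᶠ k : ℤ, nPsi l false p (1 - k) false q k x

/-- `ê**^{pq} = Σ_{r ∈ ½+ℤ} :ψ^{+,p}_{-r} ψ^{+,q}_{r}:`. -/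
def estarstar (l : ℕ) (p q : Fin l) : FFock l → FFock l :=
  fun x => ∑ᶠ k : ℤ, nPsi l true p (1 - k) true q k x

/-- `Ξ^{ε,m}_p = ψ^{ε,p}_{-m+½} ⋯ ψ^{ε,p}_{-3/2} ψ^{ε,p}_{-½}` (a product of `m` creation
operators; `Ξ^{ε,0}_p = 1`). -/
def Xi (l : ℕ) (ε : Bool) (p : Fin l) : ℕ → FFock l → FFock l
  | 0 => id
  | m + 1 => fun x => psiCr l ε p m (Xi l ε p m x)

/-- `D̂_{ij} := Ê_{ij} - Ê_{1-j,1-i}`. -/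
def Dhat (l : ℕ) (i j : ℤ) : FFock l → FFock l :=
  fun x => Ehat l i j x - Ehat l (1 - j) (1 - i) x

section Modes

variable {l : ℕ}

theorem psiCr_zero (ε : Bool) (p : Fin l) (n : ℕ) : psiCr l ε p n 0 = 0 := by
  simp [psiCr]

theorem psiAn_zero (ε : Bool) (p : Fin l) (n : ℕ) : psiAn l ε p n 0 = 0 := by
  simp [psiAn]

theorem fermion_zero (ε : Bool) (p : Fin l) (k : ℤ) : fermion l ε p k 0 = 0 := by
  unfold fermion
  split_ifs
  · exact psiCr_zero _ _ _
  · exact psiAn_zero _ _ _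

theorem psiCr_self (ε : Bool) (p : Fin l) (n : ℕ) (x : FFock l) :
    psiCr l ε p n (psiCr l ε p n x) = 0 := by
  simp [psiCr, ← mul_assoc]

theorem psiCr_anticomm (ε ε' : Bool) (p q : Fin l) (n k : ℕ) (x : FFock l) :
    psiCr l ε p n (psiCr l ε' q k x) = -psiCr l ε' q k (psiCr l ε p n x) := by
  have h := ExteriorAlgebra.ι_add_mul_swap (R := ℂ)
    (Finsupp.single ((ε, p, n) : FBas l) (1 : ℂ)) (Finsupp.single ((ε', q, k) : FBas l) (1 : ℂ))
  simp only [psiCr, ← mul_assoc]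
  rw [eq_neg_of_add_eq_zero_left h, neg_mul]

theorem psiAn_anticomm (ε ε' : Bool) (p q : Fin l) (n k : ℕ) (x : FFock l) :
    psiAn l ε p n (psiAn l ε' q k x) = -psiAn l ε' q k (psiAn l ε p n x) :=
  CliffordAlgebra.contractLeft_comm ..

theorem psiAn_psiCr (ε ε' : Bool) (p q : Fin l) (n k : ℕ) (x : FFock l) :
    psiAn l ε p n (psiCr l ε' q k x)
      = (if (ε', q, k) = (!ε, p, n) then x else 0) - psiCr l ε' q k (psiAn l ε p n x) := by
  unfold psiAn psiCr
  refine (CliffordAlgebra.contractLeft_ι_mul ..).trans ?_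
  congr 1
  rw [Finsupp.lapply_apply, Finsupp.single_apply]
  split_ifs <;> simp

theorem psiAn_fvac (ε : Bool) (p : Fin l) (n : ℕ) : psiAn l ε p n (fvac l) = 0 :=
  CliffordAlgebra.contractLeft_one ..

theorem fermion_of_nonpos (ε : Bool) (p : Fin l) {k : ℤ} (hk : k ≤ 0) :
    fermion l ε p k = psiCr l ε p (-k).toNat := if_pos hk

theorem fermion_of_pos (ε : Bool) (p : Fin l) {k : ℤ} (hk : 1 ≤ k) :
    fermion l ε p k = psiAn l ε p (k - 1).toNat := if_neg (by omega)

theorem fermion_anticomm {ε ε' : Bool} {p q : Fin l} {a b : ℤ}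
    (h : ¬(ε' = !ε ∧ p = q ∧ a + b = 1)) (x : FFock l) :
    fermion l ε p a (fermion l ε' q b x) = -fermion l ε' q b (fermion l ε p a x) := by
  rcases le_or_gt a 0 with ha | ha <;> rcases le_or_gt b 0 with hb | hb
  · simp only [fermion_of_nonpos, ha, hb, psiCr_anticomm ε ε']
  · rw [fermion_of_nonpos _ _ ha, fermion_of_pos _ _ hb, psiAn_psiCr, if_neg, zero_sub, neg_neg]
    rintro heq
    simp only [Prod.mk.injEq] at heq
    refine h ⟨by rw [heq.1, Bool.not_not], heq.2.1, by omega⟩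
  · rw [fermion_of_nonpos _ _ hb, fermion_of_pos _ _ ha, psiAn_psiCr, if_neg, zero_sub]
    rintro heq
    simp only [Prod.mk.injEq] at heq
    exact h ⟨heq.1, heq.2.1.symm, by omega⟩
  · rw [fermion_of_pos _ _ ha, fermion_of_pos _ _ hb, psiAn_anticomm]

/-- A normal ordered product of two non-conjugate modes kills every vector killed by one of
them. -/
theorem nPsi_eq_zero {ε ε' : Bool} {p q : Fin l} {a b : ℤ} {x : FFock l}
    (h : ¬(ε' = !ε ∧ p = q ∧ a + b = 1))
    (hx : fermion l ε p a x = 0 ∨ fermion l ε' q b x = 0) :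
    nPsi l ε p a ε' q b x = 0 := by
  have key : fermion l ε p a (fermion l ε' q b x) = 0 := by
    rcases hx with hx | hx
    · rw [fermion_anticomm h, hx, fermion_zero, neg_zero]
    · rw [hx, fermion_zero]
  unfold nPsi
  split_ifs
  · exact (fermion_anticomm h x).symm.trans key
  · exact key

theorem psiCr_psiAn_of_psiCr_eq_zero {ε : Bool} {p : Fin l} {n : ℕ} {x : FFock l}
    (hx : psiCr l ε p n x = 0) : psiCr l ε p n (psiAn l (!ε) p n x) = x := by
  have h := psiAn_psiCr (!ε) ε p p n n x
  rw [hx, psiAn_zero, if_pos (by simp)] at h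
  exact (sub_eq_zero.mp h.symm).symm

theorem nPsi_diag_of_pos (p : Fin l) {k : ℤ} (hk : 1 ≤ k) (x : FFock l) :
    nPsi l true p (1 - k) false p k x
      = psiCr l true p (k - 1).toNat (psiAn l false p (k - 1).toNat x) := by
  unfold nPsi
  rw [if_neg (by omega), fermion_of_nonpos _ _ (by omega), fermion_of_pos _ _ hk, neg_sub]

theorem nPsi_diag_of_nonpos (p : Fin l) {k : ℤ} (hk : k ≤ 0) (x : FFock l) :
    nPsi l true p (1 - k) false p k x
      = -psiCr l false p (-k).toNat (psiAn l true p (-k).toNat x) := by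
  unfold nPsi
  rw [if_pos (by omega), fermion_of_nonpos _ _ hk, fermion_of_pos _ _ (by omega)]
  simp only [sub_sub_cancel_left]

theorem psiCr_Xi {ε ε' : Bool} {p q : Fin l} {n : ℕ} {x : FFock l} (M : ℕ)
    (h : psiCr l ε p n x = 0 ∨ (ε = ε' ∧ p = q ∧ n < M)) :
    psiCr l ε p n (Xi l ε' q M x) = 0 := by
  induction M with
  | zero => simpa [Xi] using h
  | succ M ih =>
    by_cases heq : ε = ε' ∧ p = q ∧ n = M
    · obtain ⟨rfl, rfl, rfl⟩ := heq
      exact psiCr_self ..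
    · rw [Xi, psiCr_anticomm, ih, psiCr_zero, neg_zero]
      refine h.imp_right fun ⟨h₁, h₂, h₃⟩ => ⟨h₁, h₂, ?_⟩
      have : n ≠ M := fun h' => heq ⟨h₁, h₂, h'⟩
      omega

theorem psiAn_Xi {ε ε' : Bool} {p q : Fin l} {n : ℕ} {x : FFock l} (M : ℕ)
    (hx : psiAn l ε p n x = 0) (h : ¬(ε' = !ε ∧ q = p ∧ n < M)) :
    psiAn l ε p n (Xi l ε' q M x) = 0 := by
  induction M with
  | zero => simpa [Xi] using hx
  | succ M ih =>
    rw [Xi, psiAn_psiCr, ih, psiCr_zero, if_neg, sub_zero]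
    · simp only [Prod.mk.injEq]
      rintro ⟨h₁, h₂, h₃⟩
      exact h ⟨h₁, h₂, by omega⟩
    · rintro ⟨h₁, h₂, h₃⟩
      exact h ⟨h₁, h₂, by omega⟩

end Modes

section Occupation

variable {l : ℕ}

/-- The vector `Ξ^{+,m₁}_1 ⋯ Ξ^{+,m_j}_j Ξ^{det}_j |0⟩`, with the product restricted to a list
of colours. -/
def detVec (j : ℕ) (m : Fin l → ℤ) (L : List (Fin l)) : FFock l :=
  L.foldr
    (fun (p : Fin l) acc =>
      if (p : ℕ) < j then Xi l true p (m p).toNat acc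
      else psiCr l true p 0 (psiCr l false p 0 acc))
    (fvac l)

theorem detVec_cons (j : ℕ) (m : Fin l → ℤ) (p : Fin l) (L : List (Fin l)) :
    detVec j m (p :: L) = if (p : ℕ) < j then Xi l true p (m p).toNat (detVec j m L)
      else psiCr l true p 0 (psiCr l false p 0 (detVec j m L)) := rfl

/-- `v^{ε,p}_{-(n+½)}` is a factor of the vector `Ξ^{+,m₁}_1 ⋯ Ξ^{+,m_j}_j Ξ^{det}_j |0⟩`. -/
def Occupied (j : ℕ) (m : Fin l → ℤ) (ε : Bool) (p : Fin l) (n : ℕ) : Prop :=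
  ((p : ℕ) < j ∧ ε = true ∧ (n : ℤ) < m p) ∨ (¬(p : ℕ) < j ∧ n = 0)

theorem psiCr_detVec {j : ℕ} {m : Fin l → ℤ} {ε : Bool} {p : Fin l} {n : ℕ}
    (h : Occupied j m ε p n) (L : List (Fin l)) (hp : p ∈ L) :
    psiCr l ε p n (detVec j m L) = 0 := by
  induction L with
  | nil => simp at hp
  | cons q L ih =>
    rw [detVec_cons]
    by_cases hpq : p = q
    · subst hpq
      rcases h with ⟨hj, rfl, hn⟩ | ⟨hj, rfl⟩
      · rw [if_pos hj]
        exact psiCr_Xi _ (Or.inr ⟨rfl, rfl, by omega⟩)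
      · rw [if_neg hj]
        cases ε
        · rw [psiCr_anticomm, psiCr_self, psiCr_zero, neg_zero]
        · exact psiCr_self ..
    · have hx := ih ((List.mem_cons.mp hp).resolve_left hpq)
      split_ifs
      · exact psiCr_Xi _ (Or.inl hx)
      · rw [psiCr_anticomm, psiCr_anticomm ε false, hx]
        simp [psiCr]

theorem psiAn_detVec {j : ℕ} {m : Fin l → ℤ} {ε : Bool} {p : Fin l} {n : ℕ}
    (h : ¬Occupied j m (!ε) p n) (L : List (Fin l)) :
    psiAn l ε p n (detVec j m L) = 0 := by
  induction L with
  | nil => exact psiAn_fvac ..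
  | cons q L ih =>
    rw [detVec_cons]
    split_ifs with hq
    · refine psiAn_Xi _ ih ?_
      rintro ⟨h₁, rfl, h₂⟩
      exact h (Or.inl ⟨hq, h₁.symm, by omega⟩)
    · have hne (ε' : Bool) : ¬(ε', q, 0) = (!ε, p, n) := by
        simp only [Prod.mk.injEq]
        rintro ⟨-, rfl, rfl⟩
        exact h (Or.inr ⟨hq, rfl⟩)
      rw [psiAn_psiCr, psiAn_psiCr, ih, if_neg (hne _), if_neg (hne _)]
      simp [psiCr_zero]

end Occupation

/-- for `1 ≤ j < l` and integers `m₁ ≥ … ≥ m_j > 0`, the vector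
`v = Ξ^{+,m₁}_1 ⋯ Ξ^{+,m_j}_j Ξ^{det}_j |0⟩`, where
`Ξ^{det}_j = ∏_{p=j+1}^{l} ψ^{+,p}_{-½} ψ^{-,p}_{-½}`, is annihilated by all
`D̂_{ab} = Ê_{ab} - Ê_{1-b,1-a}` with `a < b`, by all `ê*^{pq}` with `p < q` and all
`ê**^{pq}` with `p ≠ q`, and is an eigenvector of the `Ê_{kk}` with the indicated
eigenvalues. -/
theorem hwvector_det_dinf (l : ℕ) (j : ℕ) (hj1 : 1 ≤ j) (hjl : j < l)
    (m : Fin l → ℤ)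
    (hm : ∀ p q : Fin l, p ≤ q → (q : ℕ) < j → m q ≤ m p)
    (hpos : ∀ p : Fin l, (p : ℕ) < j → 0 < m p)
    (v : FFock l)
    (hv : v = (List.finRange l).foldr
      (fun (p : Fin l) acc =>
        if (p : ℕ) < j then Xi l true p (m p).toNat acc
        else psiCr l true p 0 (psiCr l false p 0 acc))
      (fvac l)) :
    (∀ a b : ℤ, a < b → Dhat l a b v = 0) ∧
    (∀ p q : Fin l, p < q → estar l p q v = 0) ∧
    (∀ p q : Fin l, p ≠ q → estarstar l p q v = 0) ∧
    (∀ k : ℤ, 2 ≤ k →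
      Ehat l k k v
        = (((Finset.univ.filter (fun p : Fin l => (p : ℕ) < j ∧ k ≤ m p)).card : ℂ)) • v) ∧
    (Ehat l 1 1 v = (l : ℂ) • v) ∧
    (Ehat l 0 0 v = ((j : ℂ) - (l : ℂ)) • v) ∧
    (∀ k : ℤ, k ≤ -1 → Ehat l k k v = 0) := by
  change v = detVec j m (List.finRange l) at hv
  have hcr {ε : Bool} {p : Fin l} {n : ℕ} (h : Occupied j m ε p n) : psiCr l ε p n v = 0 :=
    hv ▸ psiCr_detVec h _ (List.mem_finRange p)
  have han {ε : Bool} {p : Fin l} {n : ℕ} (h : ¬Occupied j m (!ε) p n) : psiAn l ε p n v = 0 :=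
    hv ▸ psiAn_detVec h _
  clear hv
  have fcr {ε : Bool} {p : Fin l} {k : ℤ} (hk : k ≤ 0) (h : Occupied j m ε p (-k).toNat) :
      fermion l ε p k v = 0 := by
    rw [fermion_of_nonpos _ _ hk, hcr h]
  have fan {ε : Bool} {p : Fin l} {k : ℤ} (hk : 1 ≤ k)
      (h : ¬Occupied j m (!ε) p (k - 1).toNat) : fermion l ε p k v = 0 := by
    rw [fermion_of_pos _ _ hk, han h]
  have hE {a b : ℤ} (hab : a < b) (h01 : ¬(a = 0 ∧ b = 1)) : Ehat l a b v = 0 := by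
    refine Finset.sum_eq_zero fun p _ => nPsi_eq_zero (by omega) ?_
    by_cases hb : 1 ≤ b ∧ ¬Occupied j m true p (b - 1).toNat
    · exact Or.inr (fan hb.1 hb.2)
    by_cases ha : a ≤ 0
    · by_cases ha' : Occupied j m false p (1 - a - 1).toNat
      · simp only [Occupied, Bool.false_eq_true, true_and, false_and, and_false, false_or,
          not_and, not_not] at ha' hb
        exfalso
        omega
      · exact Or.inl (fan (by omega) ha')
    · refine Or.inl (fcr (by omega) ?_)
      simp only [Occupied, true_and] at hb ⊢
      omega
  have hdiag {k : ℤ} {p : Fin l} (hk : 1 ≤ k) (h : Occupied j m true p (k - 1).toNat) :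
      nPsi l true p (1 - k) false p k v = v := by
    rw [nPsi_diag_of_pos _ hk]
    exact psiCr_psiAn_of_psiCr_eq_zero (hcr h)
  have hdiag' {k : ℤ} {p : Fin l} (hk : k ≤ 0) (h : Occupied j m false p (-k).toNat) :
      nPsi l true p (1 - k) false p k v = -v := by
    rw [nPsi_diag_of_nonpos _ hk]
    exact congrArg _ (psiCr_psiAn_of_psiCr_eq_zero (hcr h))
  have hdiag₀ {k : ℤ} {p : Fin l} (hk : 1 ≤ k) (h : ¬Occupied j m true p (k - 1).toNat) :
      nPsi l true p (1 - k) false p k v = 0 := by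
    rw [nPsi_diag_of_pos _ hk, han (ε := false) h, psiCr_zero]
  have hdiag₀' {k : ℤ} {p : Fin l} (hk : k ≤ 0) (h : ¬Occupied j m false p (-k).toNat) :
      nPsi l true p (1 - k) false p k v = 0 := by
    rw [nPsi_diag_of_nonpos _ hk, han (ε := true) h, psiCr_zero, neg_zero]
  refine ⟨fun a b hab => ?_, fun p q hpq => ?_, fun p q hpq => ?_, fun k hk => ?_, ?_, ?_,
    fun k hk => ?_⟩
  · by_cases h01 : a = 0 ∧ b = 1
    · obtain ⟨rfl, rfl⟩ := h01
      exact sub_self _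
    · rw [Dhat, hE hab h01, hE (by omega) (by omega), sub_zero]
  · refine finsum_eq_zero_of_forall_eq_zero fun k => nPsi_eq_zero (by simp [hpq.ne]) ?_
    have hlt : (p : ℕ) < q := hpq
    have hmpq := hm p q hpq.le
    have hp := hpos p
    rcases le_or_gt k 0 with hk | hk
    · by_cases h : Occupied j m false p (1 - k - 1).toNat
      · refine Or.inr (fcr hk ?_)
        simp only [Occupied, Bool.false_eq_true, false_and, and_false, false_or] at h ⊢
        omega
      · exact Or.inl (fan (by omega) h)
    · by_cases h : Occupied j m true q (k - 1).toNat
      · refine Or.inl (fcr (by omega) ?_)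
        simp only [Occupied, true_and] at h ⊢
        omega
      · exact Or.inr (fan hk h)
  · refine finsum_eq_zero_of_forall_eq_zero fun k => nPsi_eq_zero (by simp) ?_
    have hp := hpos p
    have hq := hpos q
    rcases le_or_gt k 0 with hk | hk
    · by_cases h : Occupied j m false p (1 - k - 1).toNat
      · refine Or.inr (fcr hk ?_)
        simp only [Occupied, Bool.false_eq_true, false_and, and_false, false_or, true_and] at h ⊢
        omega
      · exact Or.inl (fan (by omega) h)
    · by_cases h : Occupied j m false q (k - 1).toNat
      · refine Or.inl (fcr (by omega) ?_)
        simp only [Occupied, Bool.false_eq_true, false_and, and_false, false_or, true_and] at h ⊢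
        omega
      · exact Or.inr (fan hk h)
  · have hterm (p : Fin l) : nPsi l true p (1 - k) false p k v
        = if (p : ℕ) < j ∧ k ≤ m p then v else 0 := by
      split_ifs with h
      · exact hdiag (by omega) (Or.inl ⟨h.1, rfl, by omega⟩)
      · refine hdiag₀ (by omega) ?_
        simp only [Occupied, true_and]
        omega
    rw [Ehat, Finset.sum_congr rfl fun p _ => hterm p, ← Finset.sum_filter, Finset.sum_const,
      Nat.cast_smul_eq_nsmul]
  · have hterm (p : Fin l) : nPsi l true p (1 - 1) false p 1 v = v := by
      refine hdiag le_rfl ?_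
      have hp := hpos p
      simp only [Occupied, true_and]
      omega
    rw [Ehat, Finset.sum_congr rfl fun p _ => hterm p, Finset.sum_const, Finset.card_univ,
      Fintype.card_fin, Nat.cast_smul_eq_nsmul]
  · have hterm (p : Fin l) : nPsi l true p (1 - 0) false p 0 v
        = (if (p : ℕ) < j then v else 0) - v := by
      split_ifs with h
      · rw [sub_self]
        exact hdiag₀' le_rfl (by simp [Occupied, h])
      · rw [zero_sub]
        exact hdiag' le_rfl (Or.inr ⟨h, rfl⟩)
    have hcard : (Finset.univ.filter fun p : Fin l => (p : ℕ) < j).card = j := by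
      rw [Fin.card_filter_val_lt, min_eq_right hjl.le]
    rw [Ehat, Finset.sum_congr rfl fun p _ => hterm p, Finset.sum_sub_distrib,
      ← Finset.sum_filter, Finset.sum_const, Finset.sum_const, hcard, Finset.card_univ,
      Fintype.card_fin, sub_smul, Nat.cast_smul_eq_nsmul, Nat.cast_smul_eq_nsmul]
  · refine Finset.sum_eq_zero fun p _ => hdiag₀' (by omega) ?_
    simp only [Occupied, Bool.false_eq_true, false_and, and_false, false_or]
    omega

end
end

section
/- Let m₁ ≥ m₂ ≥ … ≥ m_l be integers, let i := #{p : m_p > 0} and j := l − #{p : m_p < 0} (so m_p = 0 for i < p ≤ j), and set m_{i+1} := 0. Define v := (∏_{k=1}^{i} Γ^{+,m_k−m_{k+1}}_k) · Γ^{−,−m_{j+1}}_{j+1} · (∏_{k=j+2}^{l} Γ^{−,m_{k−1}−m_k}_k) |0⟩ ∈ F (the Γ⁻ factors being present only when j < l). Then: (a) Ê_{ab} v = 0 for all a < b; (b) ê*^{pq} v = 0 for all p < q, and ê*^{pp} v = −m_p·v for all p; (c) Ê_{kk} v = m_k·v for 1 ≤ k ≤ i and Ê_{kk} v = 0 for k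 > i; (d) Ê_{−k,−k} v = m_{l−k}·v for 0 ≤ k ≤ l−j−1 and Ê_{−k,−k} v = 0 for k ≥ l−j. -/
/-!
Bosonic Fock space of `l` pairs of bosonic ghost fields indexed by `½ + ℤ`.

The Fock space `BFock l` is the polynomial algebra `ℂ[x^{ε,p}_r]` with
`ε ∈ {+,-}` (encoded as `Bool`, `true = +`), `1 ≤ p ≤ l` (encoded as `Fin l`) and
`r ∈ ½+ℤ`, `r > 0` (encoded as `n : ℕ` with `r = n + ½`), with vacuum `|0⟩ = 1`.

For `r > 0`, `γ^{ε,p}_{-r}` is multiplication by `x^{ε,p}_r`, while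
`γ^{+,p}_{r} = ∂/∂x^{-,p}_r` and `γ^{-,p}_{r} = -∂/∂x^{+,p}_r`.
A general mode `γ^{ε,p}_{k-½}` is encoded by `boson ε p k` for `k : ℤ`.
-/

noncomputable section

/-- Variable index: `(ε, p, n)` corresponds to `x^{ε,p}_{n+½}`. -/
abbrev BBas (l : ℕ) := Bool × Fin l × ℕ

/-- The bosonic Fock space: the polynomial algebra on the variables `x^{ε,p}_r`. -/
abbrev BFock (l : ℕ) := MvPolynomial (BBas l) ℂ

/-- The vacuum vector `|0⟩ = 1`. -/
def bvac (l : ℕ) : BFock l := 1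

/-- Creation operator `γ^{ε,p}_{-(n+½)}`: multiplication by `x^{ε,p}_{n+½}`. -/
def gamCr (l : ℕ) (ε : Bool) (p : Fin l) (n : ℕ) : BFock l → BFock l :=
  fun f => MvPolynomial.X ((ε, p, n) : BBas l) * f

/-- Annihilation operator: `γ^{+,p}_{n+½} = ∂/∂x^{-,p}_{n+½}` and
`γ^{-,p}_{n+½} = -∂/∂x^{+,p}_{n+½}`. -/
def gamAn (l : ℕ) (ε : Bool) (p : Fin l) (n : ℕ) : BFock l → BFock l :=
  if ε then fun f => MvPolynomial.pderiv ((false, p, n) : BBas l) f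
  else fun f => -(MvPolynomial.pderiv ((true, p, n) : BBas l) f)

/-- `boson ε p k` is the mode `γ^{ε,p}_{k-½}`, for `k : ℤ`. -/
def boson (l : ℕ) (ε : Bool) (p : Fin l) (k : ℤ) : BFock l → BFock l :=
  if k ≤ 0 then gamCr l ε p (-k).toNat else gamAn l ε p (k - 1).toNat

/-- Normal ordered product `:γ^{ε₁,p₁}_{k₁-½} γ^{ε₂,p₂}_{k₂-½}:`, which is `γ₂ γ₁` if
`k₁ - ½ > 0 > k₂ - ½` and `γ₁ γ₂` otherwise. -/
def nGam (l : ℕ) (ε₁ : Bool) (p₁ : Fin l) (k₁ : ℤ) (ε₂ : Bool) (p₂ : Fin l) (k₂ : ℤ) :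
    BFock l → BFock l :=
  if 1 ≤ k₁ ∧ k₂ ≤ 0 then fun x => boson l ε₂ p₂ k₂ (boson l ε₁ p₁ k₁ x)
  else fun x => boson l ε₁ p₁ k₁ (boson l ε₂ p₂ k₂ x)

/-- `Ê_{ij} = -Σ_{p=1}^{l} :γ^{+,p}_{½-i} γ^{-,p}_{j-½}:`. -/
def bEhat (l : ℕ) (i j : ℤ) : BFock l → BFock l :=
  fun x => -(∑ p : Fin l, nGam l true p (1 - i) false p j x)

/-- `ê*^{pq} = Σ_{r∈½+ℤ} :γ^{+,p}_{-r} γ^{-,q}_{r}:` (a locally finite sum; `r = k - ½`). -/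
def bestar (l : ℕ) (p q : Fin l) : BFock l → BFock l :=
  fun x => ∑ᶠ k : ℤ, nGam l true p (1 - k) false q k x

/-- `ê^{pq} = Σ_{r∈½+ℤ} :γ^{-,p}_{-r} γ^{-,q}_{r}:`. -/
def bee (l : ℕ) (p q : Fin l) : BFock l → BFock l :=
  fun x => ∑ᶠ k : ℤ, nGam l false p (1 - k) false q k x

/-- `ê**^{pq} = Σ_{r∈½+ℤ} :γ^{+,p}_{-r} γ^{+,q}_{r}:`. -/
def bestarstar (l : ℕ) (p q : Fin l) : BFock l → BFock l :=
  fun x => ∑ᶠ k : ℤ, nGam l true p (1 - k) true q k x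

/-- The polynomial `Γ⁺_i`: the determinant of the `i×i` matrix with `(a,b)` entry
`γ^{+,a}_{-b+½}` (all entries are multiplications by variables, which commute, so the
determinant operator is multiplication by the determinant of the matrix of variables). -/
def PPlus (l : ℕ) (i : ℕ) (h : i ≤ l) : BFock l :=
  (Matrix.of fun a b : Fin i =>
    MvPolynomial.X ((true, Fin.castLE h a, (b : ℕ)) : BBas l)).det

/-- The polynomial `Γ⁻_s` (`s = l+1-i` in the notation of the paper, an `(l+1-s)×(l+1-s)`
determinant): the `(a,b)` entry is `γ^{-,l+1-a}_{-b+½}`. -/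
def PMinus (l : ℕ) (s : ℕ) (h1 : 1 ≤ s) (h2 : s ≤ l) : BFock l :=
  (Matrix.of fun a b : Fin (l + 1 - s) =>
    MvPolynomial.X ((false, (⟨l - 1 - (a : ℕ), by have := a.2; omega⟩ : Fin l), (b : ℕ)) :
      BBas l)).det

section DerivationDet

theorem Derivation.finset_sum_apply {R A M ι : Type*} [CommSemiring R] [CommSemiring A]
    [AddCommMonoid M] [Algebra R A] [Module A M] [Module R M] (s : Finset ι)
    (D : ι → Derivation R A M) (f : A) : (∑ i ∈ s, D i) f = ∑ i ∈ s, D i f := by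
  classical
  induction s using Finset.induction_on with
  | empty => simp
  | insert a s ha ih =>
    rw [Finset.sum_insert ha, Finset.sum_insert ha, Derivation.add_apply, ih]

variable {R S : Type*} [CommRing R] [CommRing S] [Algebra R S]

theorem Derivation.leibniz_finset_prod {ι : Type*} [DecidableEq ι] (D : Derivation R S S)
    (s : Finset ι) (f : ι → S) :
    D (∏ i ∈ s, f i) = ∑ i ∈ s, ∏ j ∈ s, Function.update f i (D (f i)) j := by
  induction s using Finset.induction_on with
  | empty => simp
  | insert a s ha ih =>
    rw [Finset.prod_insert ha, D.leibniz, Finset.sum_insert ha, ih, Finset.prod_insert ha,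
      Function.update_self, smul_eq_mul, smul_eq_mul, add_comm]
    congr 1
    · rw [mul_comm]
      congr 1
      refine Finset.prod_congr rfl fun j hj => ?_
      rw [Function.update_of_ne (by rintro rfl; exact ha hj)]
    · rw [Finset.mul_sum]
      refine Finset.sum_congr rfl fun i hi => ?_
      rw [Finset.prod_insert ha, Function.update_of_ne (by rintro rfl; exact ha hi)]

variable {n : Type*} [Fintype n] [DecidableEq n]

theorem Derivation.leibniz_det (D : Derivation R S S) (A : Matrix n n S) :
    D A.det = ∑ c, (A.updateCol c fun r => D (A r c)).det := by
  simp_rw [Matrix.det_apply, map_sum]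
  rw [Finset.sum_comm]
  refine Finset.sum_congr rfl fun σ _ => ?_
  rw [← Finset.smul_sum]
  have h : D (∏ i, A (σ i) i)
      = ∑ c, ∏ i, (A.updateCol c fun r => D (A r c)) (σ i) i := by
    rw [D.leibniz_finset_prod]
    refine Finset.sum_congr rfl fun c _ => Finset.prod_congr rfl fun i _ => ?_
    by_cases hi : i = c
    · subst hi; simp
    · simp [hi]
  rw [← h]
  rcases Int.units_eq_one_or (Equiv.Perm.sign σ) with h' | h' <;> simp [h']

theorem Derivation.det_eq_zero_of_forall (D : Derivation R S S) (A : Matrix n n S)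
    (h : ∀ r c, D (A r c) = 0) : D A.det = 0 := by
  rw [D.leibniz_det]
  refine Finset.sum_eq_zero fun c _ => Matrix.det_eq_zero_of_column_eq_zero c fun r => ?_
  simp [h]

/-- A derivation acting on the entries of `A` by `s` times the elementary operation replacing
column `b` by column `a` has `det A` as an eigenvector. -/
theorem Derivation.det_of_col (D : Derivation R S S) (A : Matrix n n S) (a b : n) (s : R)
    (h : ∀ r c, D (A r c) = if c = b then s • A r a else 0) :
    D A.det = (if a = b then s else 0) • A.det := by
  rw [D.leibniz_det, Finset.sum_eq_single b]
  · have hc : (fun r => D (A r b)) = algebraMap R S s • fun r => A r a := by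
      ext r; simp [h, Algebra.smul_def]
    rw [hc, Matrix.det_updateCol_smul]
    by_cases hab : a = b
    · subst hab
      simp [Algebra.smul_def, Matrix.updateCol_eq_self]
    · rw [Matrix.det_updateCol_eq_zero hab]
      simp [hab]
  · intro c _ hc
    refine Matrix.det_eq_zero_of_column_eq_zero c fun r => ?_
    simp [h, hc]
  · simp

/-- A derivation acting on the entries of `A` by `s` times the elementary operation replacing
row `b` by row `a` has `det A` as an eigenvector. -/
theorem Derivation.det_of_row (D : Derivation R S S) (A : Matrix n n S) (a b : n) (s : R)
    (h : ∀ r c, D (A r c) = if r = b then s • A a c else 0) :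
    D A.det = (if a = b then s else 0) • A.det := by
  rw [← Matrix.det_transpose]
  exact D.det_of_col A.transpose a b s fun r c => h c r

theorem Derivation.mul_eigen (D : Derivation R S S) {f g : S} {c d : R}
    (hf : D f = c • f) (hg : D g = d • g) : D (f * g) = (c + d) • (f * g) := by
  rw [D.leibniz, hf, hg]
  simp only [smul_eq_mul, Algebra.smul_def, map_add]
  ring

theorem Derivation.pow_eigen (D : Derivation R S S) {f : S} {c : R} (hf : D f = c • f) (e : ℕ) :
    D (f ^ e) = ((e : R) * c) • f ^ e := by
  induction e with
  | zero => simp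
  | succ e ih =>
    rw [pow_succ, D.mul_eigen ih hf]
    push_cast
    ring_nf

theorem Derivation.prod_eigen {ι : Type*} (D : Derivation R S S) (s : Finset ι) (f : ι → S)
    (c : ι → R) (h : ∀ i ∈ s, D (f i) = c i • f i) :
    D (∏ i ∈ s, f i) = (∑ i ∈ s, c i) • ∏ i ∈ s, f i := by
  classical
  induction s using Finset.induction_on with
  | empty => simp
  | insert a s ha ih =>
    rw [Finset.prod_insert ha, Finset.sum_insert ha]
    exact D.mul_eigen (h a (Finset.mem_insert_self a s))
      (ih fun i hi => h i (Finset.mem_insert_of_mem hi))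

end DerivationDet

theorem MvPolynomial.pderiv_pderiv_comm {σ R : Type*} [CommRing R] (i j : σ)
    (f : MvPolynomial σ R) : pderiv i (pderiv j f) = pderiv j (pderiv i f) := by
  classical
  have h : ⁅(pderiv i : Derivation R (MvPolynomial σ R) (MvPolynomial σ R)),
      (pderiv j : Derivation R (MvPolynomial σ R) (MvPolynomial σ R))⁆ = 0 := by
    refine MvPolynomial.derivation_ext fun k => ?_
    rw [Derivation.commutator_apply, pderiv_X, pderiv_X]
    simp only [Pi.single_apply]
    split_ifs <;> simp
  have h' := DFunLike.congr_fun h f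
  rw [Derivation.commutator_apply] at h'
  exact sub_eq_zero.mp h'

/-- A derivation which rescales each `P k` and each `N s`, the former only for `t ≤ k` and the
latter only for `s ≤ u`, rescales the product of their powers by a telescoping sum. -/
theorem Derivation.telescoping_eigen {S : Type*} [CommRing S] [Algebra ℂ S]
    (D : Derivation ℂ S S) (P N : ℕ → S) (M : ℕ → ℤ) (l i j : ℕ) (hil : i ≤ l) (hjl : j ≤ l)
    (hpos : ∀ k, 0 < M k ↔ 1 ≤ k ∧ k ≤ i) (hneg : ∀ k, M k < 0 ↔ j + 1 ≤ k ∧ k ≤ l)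
    (hmono : ∀ k, 1 ≤ k → k + 1 ≤ l → M (k + 1) ≤ M k)
    (t u : ℕ) (α β : ℂ) (hu : u ≤ l)
    (hP : ∀ k < i, D (P k) = (if t ≤ k then α else 0) • P k)
    (hN : ∀ s, j < s → s ≤ l → D (N s) = (if s ≤ u then β else 0) • N s) :
    D ((∏ k ∈ Finset.range i,
          P k ^ (if k + 1 = i then (M i).toNat else (M (k + 1) - M (k + 2)).toNat))
        * ∏ s ∈ Finset.Icc (j + 1) l,
          N s ^ (if s = j + 1 then (-M (j + 1)).toNat else (M (s - 1) - M s).toNat))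
      = (α * ((max (M (t + 1)) 0 : ℤ) : ℂ) + β * ((max (-M u) 0 : ℤ) : ℂ)) •
        ((∏ k ∈ Finset.range i,
          P k ^ (if k + 1 = i then (M i).toNat else (M (k + 1) - M (k + 2)).toNat))
        * ∏ s ∈ Finset.Icc (j + 1) l,
          N s ^ (if s = j + 1 then (-M (j + 1)).toNat else (M (s - 1) - M s).toNat)) := by
  have hexp1 : ∀ k < i,
      (((if k + 1 = i then (M i).toNat else (M (k + 1) - M (k + 2)).toNat : ℕ)) : ℤ)
        = max (M (k + 1)) 0 - max (M (k + 1 + 1)) 0 := by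
    intro k hk
    have h1 := hpos (k + 1)
    have h2 := hpos (k + 1 + 1)
    split_ifs with h
    · subst h; omega
    · have h3 := hmono (k + 1) (by omega) (by omega)
      rw [show k + 2 = k + 1 + 1 from rfl]
      omega
  have hexp2 : ∀ s, j < s → s ≤ l →
      (((if s = j + 1 then (-M (j + 1)).toNat else (M (s - 1) - M s).toNat : ℕ)) : ℤ)
        = max (-M s) 0 - max (-M (s - 1)) 0 := by
    intro s hjs hsl
    have h1 := hneg (s - 1)
    have h2 := hneg s
    split_ifs with h
    · subst h; omega
    · have h3 := hmono (s - 1) (by omega) (by omega)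
      rw [Nat.sub_add_cancel (by omega)] at h3
      omega
  have hsum1 : ∀ n, ∑ k ∈ Finset.range n,
      ((max (M (k + 1)) 0 - max (M (k + 1 + 1)) 0 : ℤ) : ℂ) * (if t ≤ k then α else 0)
        = if t ≤ n then
            α * ((max (M (t + 1)) 0 - max (M (n + 1)) 0 : ℤ) : ℂ) else 0 := by
    intro n
    induction n with
    | zero =>
      rw [Finset.sum_range_zero]
      split_ifs with h
      · obtain rfl : t = 0 := by omega
        simp
      · rfl
    | succ n ih =>
      rw [Finset.sum_range_succ, ih]
      rcases Nat.lt_trichotomy t (n + 1) with h | h | h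
      · rw [if_pos (by omega), if_pos (by omega), if_pos (by omega)]
        push_cast
        ring
      · subst h
        simp
      · rw [if_neg (by omega), if_neg (by omega), if_neg (by omega)]
        simp
  have hsum2 : ∀ n, ∑ s ∈ Finset.Icc (j + 1) (j + n),
      ((max (-M s) 0 - max (-M (s - 1)) 0 : ℤ) : ℂ) * (if s ≤ u then β else 0)
        = β * ((max (-M (min (j + n) u)) 0 - max (-M (min j u)) 0 : ℤ) : ℂ) := by
    intro n
    induction n with
    | zero => simp
    | succ n ih =>
      rw [← add_assoc, Finset.sum_Icc_succ_top (by omega), ih, Nat.add_sub_cancel]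
      by_cases h : j + n + 1 ≤ u
      · rw [if_pos h, min_eq_left h, min_eq_left (by omega : j + n ≤ u)]
        push_cast
        ring
      · rw [if_neg h, min_eq_right (by omega : u ≤ j + n + 1),
          min_eq_right (by omega : u ≤ j + n)]
        simp
  have hprod1 := D.prod_eigen _ _ _ fun k hk => D.pow_eigen (hP k (Finset.mem_range.mp hk))
    (if k + 1 = i then (M i).toNat else (M (k + 1) - M (k + 2)).toNat)
  have hprod2 := D.prod_eigen _ _ _ fun s hs =>
    D.pow_eigen (hN s (Finset.mem_Icc.mp hs).1 (Finset.mem_Icc.mp hs).2)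
      (if s = j + 1 then (-M (j + 1)).toNat else (M (s - 1) - M s).toNat)
  rw [D.mul_eigen hprod1 hprod2]
  congr 1
  congr 1
  · have h : ∀ k ∈ Finset.range i,
        (((if k + 1 = i then (M i).toNat else (M (k + 1) - M (k + 2)).toNat : ℕ)) : ℂ)
          * (if t ≤ k then α else 0)
        = ((max (M (k + 1)) 0 - max (M (k + 1 + 1)) 0 : ℤ) : ℂ) * (if t ≤ k then α else 0) := by
      intro k hk
      rw [← hexp1 k (Finset.mem_range.mp hk), Int.cast_natCast]
    rw [Finset.sum_congr rfl h, hsum1]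
    have h1 := hpos (i + 1)
    have h2 := hpos (t + 1)
    rw [show max (M (i + 1)) 0 = 0 by omega, sub_zero]
    split_ifs with hti
    · rfl
    · rw [show max (M (t + 1)) 0 = 0 by omega]
      simp
  · have h : ∀ s ∈ Finset.Icc (j + 1) l,
        (((if s = j + 1 then (-M (j + 1)).toNat else (M (s - 1) - M s).toNat : ℕ)) : ℂ)
          * (if s ≤ u then β else 0)
        = ((max (-M s) 0 - max (-M (s - 1)) 0 : ℤ) : ℂ) * (if s ≤ u then β else 0) := by
      intro s hs
      rw [Finset.mem_Icc] at hs
      rw [← hexp2 s (by omega) hs.2, Int.cast_natCast]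
    rw [Finset.sum_congr rfl h]
    have h3 := hsum2 (l - j)
    rw [Nat.add_sub_cancel' hjl] at h3
    have h1 := hneg (min j u)
    rw [h3, min_eq_right hu, show max (-M (min j u)) 0 = 0 by omega, sub_zero]

/-- The operator `f ↦ Σ_p x^{ε,p}_{a+½} ∂f/∂x^{ε,p}_{b+½}`. -/
def colDer (l : ℕ) (ε : Bool) (a b : ℕ) : Derivation ℂ (BFock l) (BFock l) :=
  ∑ p : Fin l, (MvPolynomial.X ((ε, p, a) : BBas l) : BFock l) •
    MvPolynomial.pderiv ((ε, p, b) : BBas l)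

theorem colDer_X (l : ℕ) (ε : Bool) (a b : ℕ) (ε' : Bool) (p : Fin l) (n : ℕ) :
    colDer l ε a b (MvPolynomial.X ((ε', p, n) : BBas l))
      = if ε' = ε ∧ n = b then MvPolynomial.X ((ε, p, a) : BBas l) else 0 := by
  classical
  rw [colDer, Derivation.finset_sum_apply, Finset.sum_eq_single p]
  · rw [Derivation.smul_apply, MvPolynomial.pderiv_X, Pi.single_apply]
    simp only [Prod.mk.injEq, true_and]
    split_ifs <;> simp_all
  · intro q _ hq
    rw [Derivation.smul_apply, MvPolynomial.pderiv_X_of_ne (by simp [hq.symm]), smul_zero]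
  · simp

/-- The derivation `Σ_n (x^{-,q}_{n+½} ∂/∂x^{-,p}_{n+½} - x^{+,p}_{n+½} ∂/∂x^{+,q}_{n+½})`. -/
def rowDer (l : ℕ) (p q : Fin l) : Derivation ℂ (BFock l) (BFock l) :=
  MvPolynomial.mkDerivation ℂ fun x : BBas l =>
    if x.1 = true then
      if x.2.1 = q then -MvPolynomial.X ((true, p, x.2.2) : BBas l) else 0
    else
      if x.2.1 = p then MvPolynomial.X ((false, q, x.2.2) : BBas l) else 0

theorem nGam_nonpos (l : ℕ) (p q : Fin l) (a b : ℕ) (f : BFock l) :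
    nGam l true p (1 - -(a : ℤ)) false q (-(b : ℤ)) f
      = (MvPolynomial.X ((false, q, b) : BBas l) : BFock l) *
        MvPolynomial.pderiv ((false, p, a) : BBas l) f := by
  simp only [nGam, boson]
  rw [if_pos (by omega), if_pos (by omega), if_neg (by omega)]
  simp [gamCr, gamAn]

theorem nGam_pos (l : ℕ) (p q : Fin l) (a b : ℕ) (f : BFock l) :
    nGam l true p (1 - ((a : ℤ) + 1)) false q ((b : ℤ) + 1) f
      = -((MvPolynomial.X ((true, p, a) : BBas l) : BFock l) *
        MvPolynomial.pderiv ((true, q, b) : BBas l) f) := by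
  simp only [nGam, boson]
  rw [if_neg (by omega), if_pos (by omega), if_neg (by omega)]
  simp [gamCr, gamAn]

theorem bestar_eq_rowDer (l : ℕ) (p q : Fin l) (f : BFock l) :
    bestar l p q f = rowDer l p q f := by
  classical
  obtain ⟨N, hN⟩ : ∃ N : ℕ, ∀ x ∈ f.vars, x.2.2 < N :=
    ⟨f.vars.sup (fun x => x.2.2) + 1, fun x hx =>
      Nat.lt_succ_of_le (Finset.le_sup (f := fun x : BBas l => x.2.2) hx)⟩
  obtain ⟨e₁, he₁⟩ : ∃ e : ℕ ↪ ℤ, ∀ n, e n = -(n : ℤ) :=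
    ⟨⟨fun n => -(n : ℤ), fun a b h => by simpa using h⟩, fun _ => rfl⟩
  obtain ⟨e₂, he₂⟩ : ∃ e : ℕ ↪ ℤ, ∀ n, e n = (n : ℤ) + 1 :=
    ⟨⟨fun n => (n : ℤ) + 1, fun a b h => by simpa using h⟩, fun _ => rfl⟩
  have hdisj : Disjoint ((Finset.range N).map e₁) ((Finset.range N).map e₂) := by
    rw [Finset.disjoint_left]
    intro k h1 h2
    simp only [Finset.mem_map, he₁, he₂] at h1 h2
    obtain ⟨a, _, ha⟩ := h1
    obtain ⟨b, _, hb⟩ := h2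
    omega
  rw [bestar, finsum_eq_sum_of_support_subset (s := (Finset.range N).map e₁ ∪
    (Finset.range N).map e₂), Finset.sum_union hdisj, Finset.sum_map, Finset.sum_map]
  · simp only [he₁, he₂, nGam_nonpos, nGam_pos]
    have hsum : (∑ n ∈ Finset.range N, ((MvPolynomial.X ((false, q, n) : BBas l) : BFock l) •
          (MvPolynomial.pderiv ((false, p, n) : BBas l) :
            Derivation ℂ (BFock l) (BFock l)))
        + ∑ n ∈ Finset.range N, -((MvPolynomial.X ((true, p, n) : BBas l) : BFock l) •
          (MvPolynomial.pderiv ((true, q, n) : BBas l) :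
            Derivation ℂ (BFock l) (BFock l)))) f = rowDer l p q f := by
      refine MvPolynomial.derivation_eq_of_forall_mem_vars fun x hx => ?_
      obtain ⟨ε, r, n⟩ := x
      have hn : n < N := hN _ hx
      rw [Derivation.add_apply, Derivation.finset_sum_apply, Derivation.finset_sum_apply,
        Finset.sum_eq_single n, Finset.sum_eq_single n, rowDer, MvPolynomial.mkDerivation_X]
      · simp only [Derivation.neg_apply, Derivation.smul_apply, MvPolynomial.pderiv_X,
          Pi.single_apply, Prod.mk.injEq]
        cases ε
        · by_cases h : r = p <;> simp [h]
        · by_cases h : r = q <;> simp [h]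
      · intro b _ hb
        simp [MvPolynomial.pderiv_X, hb.symm]
      · simp [hn]
      · intro b _ hb
        simp [MvPolynomial.pderiv_X, hb.symm]
      · simp [hn]
    rw [← hsum, Derivation.add_apply, Derivation.finset_sum_apply, Derivation.finset_sum_apply]
    rfl
  · intro k hk
    by_contra hkS
    refine hk ?_
    beta_reduce
    simp only [Finset.coe_union, Finset.coe_map, Set.mem_union, Set.mem_image, Finset.mem_coe,
      Finset.mem_range, he₁, he₂, not_or, not_exists, not_and] at hkS
    rcases le_or_gt k 0 with hk0 | hk0
    · obtain ⟨n, rfl⟩ : ∃ n : ℕ, k = -(n : ℤ) := ⟨(-k).toNat, by omega⟩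
      rw [nGam_nonpos, MvPolynomial.pderiv_eq_zero_of_notMem_vars, mul_zero]
      exact fun h => hkS.1 n (hN _ h) rfl
    · obtain ⟨n, rfl⟩ : ∃ n : ℕ, k = (n : ℤ) + 1 := ⟨(k - 1).toNat, by omega⟩
      rw [nGam_pos, MvPolynomial.pderiv_eq_zero_of_notMem_vars, mul_zero, neg_zero]
      exact fun h => hkS.2 n (hN _ h) rfl

theorem bEhat_pos (l a b : ℕ) (f : BFock l) :
    bEhat l ((a : ℤ) + 1) ((b : ℤ) + 1) f = colDer l true a b f := by
  rw [colDer, Derivation.finset_sum_apply, bEhat, ← Finset.sum_neg_distrib]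
  refine Finset.sum_congr rfl fun p _ => ?_
  simp only [nGam, boson]
  rw [if_neg (by omega), if_pos (by omega), if_neg (by omega)]
  simp [gamCr, gamAn]

theorem bEhat_nonpos (l a b : ℕ) (f : BFock l) :
    bEhat l (-(a : ℤ)) (-(b : ℤ)) f = -colDer l false b a f := by
  rw [colDer, Derivation.finset_sum_apply, bEhat]
  congr 1
  refine Finset.sum_congr rfl fun p _ => ?_
  simp only [nGam, boson]
  rw [if_pos (by omega), if_pos (by omega), if_neg (by omega)]
  simp [gamCr, gamAn]

theorem bEhat_nonpos_pos (l a b : ℕ) (f : BFock l) :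
    bEhat l (-(a : ℤ)) ((b : ℤ) + 1) f = ∑ p : Fin l,
      MvPolynomial.pderiv ((false, p, a) : BBas l)
        (MvPolynomial.pderiv ((true, p, b) : BBas l) f) := by
  rw [bEhat, ← Finset.sum_neg_distrib]
  refine Finset.sum_congr rfl fun p _ => ?_
  simp only [nGam, boson]
  rw [if_neg (by omega), if_neg (by omega), if_neg (by omega)]
  simp [gamAn]

theorem derivation_PPlus_eq_zero (l : ℕ) (D : Derivation ℂ (BFock l) (BFock l)) (k : ℕ)
    (h : k ≤ l)
    (hD : ∀ (p : Fin l) (n : ℕ), (p : ℕ) < k → n < k →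
      D (MvPolynomial.X ((true, p, n) : BBas l)) = 0) : D (PPlus l k h) = 0 :=
  D.det_eq_zero_of_forall _ fun r c => hD _ _ r.2 c.2

theorem derivation_PMinus_eq_zero (l : ℕ) (D : Derivation ℂ (BFock l) (BFock l)) (s : ℕ)
    (h1 : 1 ≤ s) (h2 : s ≤ l)
    (hD : ∀ (p : Fin l) (n : ℕ), s ≤ (p : ℕ) + 1 → n + s ≤ l →
      D (MvPolynomial.X ((false, p, n) : BBas l)) = 0) : D (PMinus l s h1 h2) = 0 :=
  D.det_eq_zero_of_forall _ fun r c => hD _ _ (by simp only; omega) (by omega)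

theorem colDer_true_PPlus (l k : ℕ) (h : k + 1 ≤ l) (a b : ℕ) (hab : a ≤ b) :
    colDer l true a b (PPlus l (k + 1) h)
      = (if b ≤ k then (if a = b then 1 else 0) else 0 : ℂ) • PPlus l (k + 1) h := by
  by_cases hb : b ≤ k
  · rw [if_pos hb]
    refine ((colDer l true a b).det_of_col _ (⟨a, by omega⟩ : Fin (k + 1)) ⟨b, by omega⟩ 1
      fun r c => ?_).trans ?_
    · simp [colDer_X, Fin.ext_iff]
    · simp [PPlus, Fin.ext_iff]
  · rw [if_neg hb, zero_smul]
    refine derivation_PPlus_eq_zero _ _ _ _ fun p n _ hn => ?_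
    rw [colDer_X, if_neg (by omega)]

theorem colDer_false_PPlus (l k : ℕ) (h : k ≤ l) (a b : ℕ) :
    colDer l false a b (PPlus l k h) = 0 :=
  derivation_PPlus_eq_zero _ _ _ _ fun p n _ _ => by simp [colDer_X]

theorem colDer_true_PMinus (l s : ℕ) (h1 : 1 ≤ s) (h2 : s ≤ l) (a b : ℕ) :
    colDer l true a b (PMinus l s h1 h2) = 0 :=
  derivation_PMinus_eq_zero _ _ _ _ _ fun p n _ _ => by simp [colDer_X]

theorem colDer_false_PMinus (l s : ℕ) (h1 : 1 ≤ s) (h2 : s ≤ l) (a b : ℕ) (hab : a ≤ b) :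
    colDer l false a b (PMinus l s h1 h2)
      = (if s ≤ l - b then (if a = b then 1 else 0) else 0 : ℂ) • PMinus l s h1 h2 := by
  by_cases hb : s ≤ l - b
  · rw [if_pos hb]
    refine ((colDer l false a b).det_of_col _ (⟨a, by omega⟩ : Fin (l + 1 - s)) ⟨b, by omega⟩ 1
      fun r c => ?_).trans ?_
    · simp [colDer_X, Fin.ext_iff]
    · simp [PMinus, Fin.ext_iff]
  · rw [if_neg hb, zero_smul]
    refine derivation_PMinus_eq_zero _ _ _ _ _ fun p n _ hn => ?_
    rw [colDer_X, if_neg (by omega)]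

theorem rowDer_PPlus (l k : ℕ) (h : k + 1 ≤ l) (p q : Fin l) (hpq : p ≤ q) :
    rowDer l p q (PPlus l (k + 1) h)
      = (if (q : ℕ) ≤ k then (if p = q then -1 else 0) else 0 : ℂ) • PPlus l (k + 1) h := by
  rw [Fin.le_def] at hpq
  by_cases hq : (q : ℕ) ≤ k
  · rw [if_pos hq]
    refine ((rowDer l p q).det_of_row _ (⟨p, by omega⟩ : Fin (k + 1)) ⟨q, by omega⟩ (-1)
      fun r c => ?_).trans ?_
    · simp [rowDer, MvPolynomial.mkDerivation_X, Fin.ext_iff]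
    · simp [PPlus, Fin.ext_iff]
  · rw [if_neg hq, zero_smul]
    refine derivation_PPlus_eq_zero _ _ _ _ fun r n hr _ => ?_
    have hrq : r ≠ q := by rintro rfl; omega
    simp [rowDer, MvPolynomial.mkDerivation_X, hrq]

theorem rowDer_PMinus (l s : ℕ) (h1 : 1 ≤ s) (h2 : s ≤ l) (p q : Fin l) (hpq : p ≤ q) :
    rowDer l p q (PMinus l s h1 h2)
      = (if s ≤ (p : ℕ) + 1 then (if p = q then 1 else 0) else 0 : ℂ) • PMinus l s h1 h2 := by
  rw [Fin.le_def] at hpq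
  by_cases hp : s ≤ (p : ℕ) + 1
  · rw [if_pos hp]
    refine ((rowDer l p q).det_of_row _ (⟨l - 1 - q, by omega⟩ : Fin (l + 1 - s))
      ⟨l - 1 - p, by omega⟩ 1 fun r c => ?_).trans ?_
    · have e1 : l - 1 - (r : ℕ) = p ↔ (r : ℕ) = l - 1 - p := by omega
      have e2 : l - 1 - (l - 1 - (q : ℕ)) = q := by omega
      simp [rowDer, MvPolynomial.mkDerivation_X, Fin.ext_iff, e1, e2]
    · have e3 : l - 1 - (q : ℕ) = l - 1 - p ↔ (p : ℕ) = q := by omega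
      simp [PMinus, Fin.ext_iff, e3]
  · rw [if_neg hp, zero_smul]
    refine derivation_PMinus_eq_zero _ _ _ _ _ fun r n hr _ => ?_
    have hrp : r ≠ p := by rintro rfl; omega
    simp [rowDer, MvPolynomial.mkDerivation_X, hrp]

/-- highest weight vectors for the dual pair `(GL(l), ĝl)` on the bosonic
Fock space.  Here `M k = m_k` (1-indexed, `M k = 0` for `k` out of range),
`i = #{p : m_p > 0}`, `j = l - #{p : m_p < 0}`, and
`v = ∏_{k=1}^{i} Γ^{+,m_k - m_{k+1}}_k · Γ^{-,-m_{j+1}}_{j+1}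
· ∏_{k=j+2}^{l} Γ^{-,m_{k-1}-m_k}_k |0⟩` (with `m_{i+1}` set to `0` in the first
product). -/
theorem hwvector_GL_glhat_bosonic (l : ℕ) (hl : 1 ≤ l) (m : Fin l → ℤ)
    (hm : ∀ p q : Fin l, p ≤ q → m q ≤ m p)
    (i j : ℕ) (hil : i ≤ l) (hjl : j ≤ l) (hij : i ≤ j)
    (hi : ∀ p : Fin l, 0 < m p ↔ (p : ℕ) + 1 ≤ i)
    (hj : ∀ p : Fin l, m p < 0 ↔ j + 1 ≤ (p : ℕ) + 1)
    (M : ℕ → ℤ)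
    (hM : ∀ k : ℕ, M k = if h : 1 ≤ k ∧ k ≤ l then m ⟨k - 1, by omega⟩ else 0)
    (v : BFock l)
    (hv : v =
      (∏ k ∈ (Finset.range i).attach,
        PPlus l ((k : ℕ) + 1) (by have := Finset.mem_range.mp k.2; omega) ^
          (if (k : ℕ) + 1 = i then (M i).toNat else (M ((k : ℕ) + 1) - M ((k : ℕ) + 2)).toNat))
      * ∏ s ∈ (Finset.Icc (j + 1) l).attach,
          PMinus l (s : ℕ) (by have := (Finset.mem_Icc.mp s.2).1; omega)
              (by have := (Finset.mem_Icc.mp s.2).2; omega) ^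
            (if (s : ℕ) = j + 1 then (-M (j + 1)).toNat
             else (M ((s : ℕ) - 1) - M (s : ℕ)).toNat)) :
    (∀ a b : ℤ, a < b → bEhat l a b v = 0) ∧
    (∀ p q : Fin l, p < q → bestar l p q v = 0) ∧
    (∀ p : Fin l, bestar l p p v = (-(m p) : ℂ) • v) ∧
    (∀ k : ℕ, 1 ≤ k → k ≤ i → bEhat l (k : ℤ) (k : ℤ) v = ((M k : ℂ)) • v) ∧
    (∀ k : ℤ, (i : ℤ) < k → bEhat l k k v = 0) ∧
    (∀ k : ℕ, (k : ℤ) ≤ (l : ℤ) - (j : ℤ) - 1 →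
      bEhat l (-(k : ℤ)) (-(k : ℤ)) v = ((M (l - k) : ℂ)) • v) ∧
    (∀ k : ℕ, (l : ℤ) - (j : ℤ) ≤ (k : ℤ) → bEhat l (-(k : ℤ)) (-(k : ℤ)) v = 0) := by
  have hpos : ∀ k, 0 < M k ↔ 1 ≤ k ∧ k ≤ i := by
    intro k
    rw [hM]
    split_ifs with h
    · rw [hi]; simp only; omega
    · simp only [lt_irrefl, false_iff]; omega
  have hneg : ∀ k, M k < 0 ↔ j + 1 ≤ k ∧ k ≤ l := by
    intro k
    rw [hM]
    split_ifs with h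
    · rw [hj]; simp only; omega
    · simp only [lt_irrefl, false_iff]; omega
  have hmono : ∀ k, 1 ≤ k → k + 1 ≤ l → M (k + 1) ≤ M k := by
    intro k h1 h2
    rw [hM, hM, dif_pos ⟨by omega, h2⟩, dif_pos ⟨h1, by omega⟩]
    apply hm
    rw [Fin.mk_le_mk]; omega
  have key : ∀ (D : Derivation ℂ (BFock l) (BFock l)) (t u : ℕ) (α β : ℂ), u ≤ l →
      (∀ (k : ℕ) (h : k + 1 ≤ l), k < i →
        D (PPlus l (k + 1) h) = (if t ≤ k then α else 0) • PPlus l (k + 1) h) →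
      (∀ (s : ℕ) (h1 : 1 ≤ s) (h2 : s ≤ l), j < s →
        D (PMinus l s h1 h2) = (if s ≤ u then β else 0) • PMinus l s h1 h2) →
      D v = (α * ((max (M (t + 1)) 0 : ℤ) : ℂ) + β * ((max (-M u) 0 : ℤ) : ℂ)) • v := by
    intro D t u α β hu hP hN
    let P : ℕ → BFock l := fun k => if h : k + 1 ≤ l then PPlus l (k + 1) h else 0
    let N : ℕ → BFock l := fun s => if h : 1 ≤ s ∧ s ≤ l then PMinus l s h.1 h.2 else 0
    have hP' : ∀ (k : ℕ) (h : k + 1 ≤ l), PPlus l (k + 1) h = P k := fun k h =>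
      (dif_pos h).symm
    have hN' : ∀ (s : ℕ) (h1 : 1 ≤ s) (h2 : s ≤ l), PMinus l s h1 h2 = N s := fun s h1 h2 => by
      simp only [N]
      rw [dif_pos ⟨h1, h2⟩]
    simp only [hP', hN'] at hv hP hN
    rw [Finset.prod_attach (Finset.range i) fun k =>
        P k ^ (if k + 1 = i then (M i).toNat else (M (k + 1) - M (k + 2)).toNat),
      Finset.prod_attach (Finset.Icc (j + 1) l) fun s =>
        N s ^ (if s = j + 1 then (-M (j + 1)).toNat else (M (s - 1) - M s).toNat)] at hv
    rw [hv]
    exact D.telescoping_eigen P N M l i j hil hjl hpos hneg hmono t u α β hu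
      (fun k hk => hP k (by omega) hk) (fun s hs hsl => hN s (by omega) hsl hs)
  have hcol₁ : ∀ a b : ℕ, a ≤ b → colDer l true a b v
      = (if a = b then ((max (M (b + 1)) 0 : ℤ) : ℂ) else 0) • v := by
    intro a b hab
    rw [key (colDer l true a b) b 0 (if a = b then 1 else 0) 0 (by omega)
      (fun k h _ => colDer_true_PPlus l k h a b hab)
      (fun s h1 h2 _ => by rw [colDer_true_PMinus]; simp)]
    split_ifs <;> simp
  have hcol₂ : ∀ a b : ℕ, a ≤ b → colDer l false a b v
      = (if a = b then ((max (-M (l - b)) 0 : ℤ) : ℂ) else 0) • v := by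
    intro a b hab
    rw [key (colDer l false a b) 0 (l - b) 0 (if a = b then 1 else 0) (by omega)
      (fun k h _ => by rw [colDer_false_PPlus]; simp)
      (fun s h1 h2 _ => colDer_false_PMinus l s h1 h2 a b hab)]
    split_ifs <;> simp
  have hrow : ∀ p q : Fin l, p ≤ q → bestar l p q v
      = (if p = q then (-(m p) : ℂ) else 0) • v := by
    intro p q hpq
    rw [bestar_eq_rowDer, key (rowDer l p q) q (p + 1) (if p = q then -1 else 0)
      (if p = q then 1 else 0) (by omega)
      (fun k h _ => rowDer_PPlus l k h p q hpq)
      (fun s h1 h2 _ => rowDer_PMinus l s h1 h2 p q hpq)]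
    split_ifs with h
    · subst h
      have hMp : M ((p : ℕ) + 1) = m p := by
        rw [hM, dif_pos ⟨by omega, by omega⟩]
        rfl
      rw [hMp]
      congr 1
      rw [← Int.cast_one, ← Int.cast_neg, ← Int.cast_mul, ← Int.cast_mul, ← Int.cast_add,
        ← Int.cast_neg]
      congr 1
      omega
    · simp
  refine ⟨fun a b hab => ?_, fun p q hpq => ?_, fun p => ?_, fun k hk1 hki => ?_,
    fun k hk => ?_, fun k hk => ?_, fun k hk => ?_⟩
  · rcases le_or_gt a 0 with ha | ha
    · obtain ⟨a, rfl⟩ : ∃ n : ℕ, a = -(n : ℤ) := ⟨(-a).toNat, by omega⟩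
      rcases le_or_gt b 0 with hb | hb
      · obtain ⟨b, rfl⟩ : ∃ n : ℕ, b = -(n : ℤ) := ⟨(-b).toNat, by omega⟩
        rw [bEhat_nonpos, hcol₂ b a (by omega), if_neg (by omega), zero_smul, neg_zero]
      · obtain ⟨b, rfl⟩ : ∃ n : ℕ, b = (n : ℤ) + 1 := ⟨(b - 1).toNat, by omega⟩
        rw [bEhat_nonpos_pos]
        refine Finset.sum_eq_zero fun p _ => ?_
        rcases lt_or_ge (p : ℕ) i with hp | hp
        · rw [MvPolynomial.pderiv_pderiv_comm,
            key (MvPolynomial.pderiv ((false, p, a) : BBas l)) 0 0 0 0 (by omega)]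
          · simp
          · intro k h _
            rw [derivation_PPlus_eq_zero]
            · simp
            · intro r n _ _
              exact MvPolynomial.pderiv_X_of_ne (by simp)
          · intro s h1 h2 hs
            rw [derivation_PMinus_eq_zero]
            · simp
            · intro r n hr _
              refine MvPolynomial.pderiv_X_of_ne fun h => ?_
              simp only [Prod.mk.injEq] at h
              rw [h.2.1] at hr
              omega
        · rw [key (MvPolynomial.pderiv ((true, p, b) : BBas l)) 0 0 0 0 (by omega)]
          · simp
          · intro k h hk
            rw [derivation_PPlus_eq_zero]
            · simp
            · intro r n hr _
              refine MvPolynomial.pderiv_X_of_ne fun h => ?_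
              simp only [Prod.mk.injEq] at h
              rw [h.2.1] at hr
              omega
          · intro s h1 h2 _
            rw [derivation_PMinus_eq_zero]
            · simp
            · intro r n _ _
              exact MvPolynomial.pderiv_X_of_ne (by simp)
    · obtain ⟨a, rfl⟩ : ∃ n : ℕ, a = (n : ℤ) + 1 := ⟨(a - 1).toNat, by omega⟩
      obtain ⟨b, rfl⟩ : ∃ n : ℕ, b = (n : ℤ) + 1 := ⟨(b - 1).toNat, by omega⟩
      rw [bEhat_pos, hcol₁ a b (by omega), if_neg (by omega), zero_smul]
  · rw [hrow p q hpq.le, if_neg hpq.ne, zero_smul]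
  · rw [hrow p p le_rfl, if_pos rfl]
  · obtain ⟨k, rfl⟩ : ∃ n : ℕ, k = n + 1 := ⟨k - 1, by omega⟩
    rw [Nat.cast_add, Nat.cast_one, bEhat_pos, hcol₁ k k le_rfl, if_pos rfl,
      max_eq_left ((hpos _).mpr ⟨hk1, hki⟩).le]
  · obtain ⟨k, rfl⟩ : ∃ n : ℕ, k = (n : ℤ) + 1 := ⟨(k - 1).toNat, by omega⟩
    have h := hpos (k + 1)
    rw [bEhat_pos, hcol₁ k k le_rfl, if_pos rfl, max_eq_right (by omega), Int.cast_zero,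
      zero_smul]
  · have h := hneg (l - k)
    rw [bEhat_nonpos, hcol₂ k k le_rfl, if_pos rfl, max_eq_left (by omega), Int.cast_neg,
      neg_smul, neg_neg]
  · have h := hneg (l - k)
    rw [bEhat_nonpos, hcol₂ k k le_rfl, if_pos rfl, max_eq_right (by omega), Int.cast_zero,
      zero_smul, neg_zero]

end
end
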